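/- Let (X,d) be a cone metric space over a Banach algebra A with solid cone P, let X_n (n ∈ ℕ) and X_∞ be nonempty subsets of X, and let T_n : X_n → X and T_∞ : X_∞ → X be maps such that: (i) each T_n has a fixed point x_n; (ii) the family (T_n) has property (H) with (H)-limit T_∞; (iii) T_∞ is a k_∞-contraction w.r.t. d for some k_∞ ∈ P with ρ(k_∞) < 1; (iv) T_∞ has a unique fixed point x_∞. Then (d(x_n, x_∞))_{n∈ℕ} is a c-sequence. -/

import Mathlib

open Filter Topology

/-- Spectral radius via the Gelfand formula: `inf_{n ≥ 1} ‖k ^ n‖ ^ (1 / n)`. -/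
noncomputable def specRad {A : Type*} [NormedRing A] (k : A) : ℝ :=
  ⨅ n : ℕ, ‖k ^ (n + 1)‖ ^ ((1 : ℝ) / (n + 1))

/-- A cone in a real Banach algebra `A`: a nonempty closed subset containing `0` and `1`,
closed under nonnegative real combinations and multiplication, with `P ∩ (-P) = {0}`. -/
structure IsCone {A : Type*} [NormedRing A] [NormedAlgebra ℝ A] (P : Set A) : Prop where
  closed : IsClosed P
  zero_mem : (0 : A) ∈ P
  one_mem : (1 : A) ∈ P
  smul_mem : ∀ a : ℝ, 0 ≤ a → ∀ x ∈ P, a • x ∈ P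
  add_mem : ∀ x ∈ P, ∀ y ∈ P, x + y ∈ P
  mul_mem : ∀ x ∈ P, ∀ y ∈ P, x * y ∈ P
  antisymm : ∀ x ∈ P, -x ∈ P → x = 0

/-- A c-sequence with respect to the solid cone `P`: for every `c ≫ 0` eventually `u n ≪ c`. -/
def CSeq {A : Type*} [NormedRing A] [NormedAlgebra ℝ A] (P : Set A) (u : ℕ → A) : Prop :=
  ∀ c : A, c ∈ interior P → ∃ N : ℕ, ∀ n ≥ N, c - u n ∈ interior P

/-- A cone metric on `X` over the Banach algebra `A` with cone `P`. -/
structure IsConeMetric {A : Type*} [NormedRing A] [NormedAlgebra ℝ A] (P : Set A)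
    {X : Type*} (d : X → X → A) : Prop where
  mem_cone : ∀ x y, d x y ∈ P
  eq_zero_iff : ∀ x y, d x y = 0 ↔ x = y
  symm : ∀ x y, d x y = d y x
  triangle : ∀ x y z, d x y + d y z - d x z ∈ P

/-- Completeness of a cone metric space over a Banach algebra:
every Cauchy sequence converges (in the c-sequence sense). -/
def ConeComplete {A : Type*} [NormedRing A] [NormedAlgebra ℝ A] (P : Set A)
    {X : Type*} (d : X → X → A) : Prop :=
  ∀ u : ℕ → X,
    (∀ c : A, c ∈ interior P → ∃ N : ℕ, ∀ m ≥ N, ∀ n ≥ N, c - d (u m) (u n) ∈ interior P) →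
    ∃ x : X, CSeq P fun n => d (u n) x

/-- `Tinf` is a (G)-limit of the family `T` (property (G)). -/
def GLimit {A : Type*} [NormedRing A] [NormedAlgebra ℝ A] (P : Set A)
    {X : Type*} (d : X → X → A) (Xn : ℕ → Set X) (Xinf : Set X)
    (T : ℕ → X → X) (Tinf : X → X) : Prop :=
  ∀ x ∈ Xinf, ∃ u : ℕ → X, (∀ n, u n ∈ Xn n) ∧
    CSeq P (fun n => d (u n) x) ∧ CSeq P (fun n => d (T n (u n)) (Tinf x))

/-- `Tinf` is an (H)-limit of the family `T` (property (H)). -/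
def HLimit {A : Type*} [NormedRing A] [NormedAlgebra ℝ A] (P : Set A)
    {X : Type*} (d : X → X → A) (Xn : ℕ → Set X) (Xinf : Set X)
    (T : ℕ → X → X) (Tinf : X → X) : Prop :=
  ∀ u : ℕ → X, (∀ n, u n ∈ Xn n) → ∃ v : ℕ → X, (∀ n, v n ∈ Xinf) ∧
    CSeq P (fun n => d (u n) (v n)) ∧ CSeq P (fun n => d (T n (u n)) (Tinf (v n)))

theorem exists_norm_pow_lt_one_of_specRad_lt_one {A : Type*} [NormedRing A] {k : A}
    (h : specRad k < 1) :
    ∃ n : ℕ, ‖k ^ n‖ < 1 := by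
  obtain ⟨n, hn⟩ := exists_lt_of_ciInf_lt h
  refine ⟨n + 1, ?_⟩
  by_contra! hge
  exact absurd hn (not_lt.mpr (Real.one_le_rpow hge (by positivity)))

section ConeLemmas

variable {A : Type*} [NormedRing A] [NormedAlgebra ℝ A] {P : Set A}

theorem IsCone.add_mem_interior (hP : IsCone P) {x y : A} (hx : x ∈ P) (hy : y ∈ interior P) :
    x + y ∈ interior P := by
  have ho : IsOpen ((fun z => x + z) '' interior P) := isOpenMap_add_left x _ isOpen_interior
  refine interior_maximal ?_ ho ⟨y, hy, rfl⟩
  rintro _ ⟨z, hz, rfl⟩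
  exact hP.add_mem x hx z (interior_subset hz)

theorem IsCone.smul_mem_interior (hP : IsCone P) {t : ℝ} (ht : 0 < t) {x : A}
    (hx : x ∈ interior P) : t • x ∈ interior P := by
  have ho : IsOpen ((fun z => t • z) '' interior P) :=
    isOpenMap_smul₀ ht.ne' _ isOpen_interior
  refine interior_maximal ?_ ho ⟨x, hx, rfl⟩
  rintro _ ⟨z, hz, rfl⟩
  exact hP.smul_mem t ht.le z (interior_subset hz)

theorem IsCone.pow_mem (hP : IsCone P) {k : A} (hk : k ∈ P) (n : ℕ) : k ^ n ∈ P := by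
  induction n with
  | zero => simpa using hP.one_mem
  | succ n ih => rw [pow_succ]; exact hP.mul_mem _ ih _ hk

theorem IsCone.sum_mem (hP : IsCone P) {ι : Type*} {f : ι → A} (hf : ∀ i, f i ∈ P)
    (s : Finset ι) : ∑ i ∈ s, f i ∈ P :=
  Finset.sum_induction f (· ∈ P) (fun x y hx hy => hP.add_mem x hx y hy) hP.zero_mem
    fun i _ => hf i

theorem IsCone.tsum_mem (hP : IsCone P) {ι : Type*} {f : ι → A} (hf : ∀ i, f i ∈ P)
    (hs : Summable f) : ∑' i, f i ∈ P :=
  hP.closed.mem_of_tendsto hs.hasSum (Eventually.of_forall fun s => hP.sum_mem hf s)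

theorem CSeq.mono (hP : IsCone P) {u v : ℕ → A} (hv : CSeq P v) (h : ∀ n, v n - u n ∈ P) :
    CSeq P u := by
  intro c hc
  obtain ⟨N, hN⟩ := hv c hc
  refine ⟨N, fun n hn => ?_⟩
  simpa using hP.add_mem_interior (h n) (hN n hn)

theorem CSeq.add (hP : IsCone P) {u v : ℕ → A} (hu : CSeq P u) (hv : CSeq P v) :
    CSeq P fun n => u n + v n := by
  intro c hc
  have hc' : (1 / 2 : ℝ) • c ∈ interior P := hP.smul_mem_interior (by norm_num) hc
  obtain ⟨N, hN⟩ := hu _ hc'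
  obtain ⟨M, hM⟩ := hv _ hc'
  refine ⟨max N M, fun n hn => ?_⟩
  have h := hP.add_mem_interior (interior_subset (hN n (le_of_max_le_left hn)))
    (hM n (le_of_max_le_right hn))
  convert h using 1
  module

theorem CSeq.const_mul (hP : IsCone P) {s : A} (hs : s ∈ P) {u : ℕ → A} (hu : CSeq P u) :
    CSeq P fun n => s * u n := by
  intro c hc
  have hcont : Tendsto (fun t : ℝ => c - t • (s * c)) (𝓝[>] 0) (𝓝 c) := by
    have : Continuous fun t : ℝ => c - t • (s * c) := by fun_prop
    simpa using (this.tendsto 0).mono_left nhdsWithin_le_nhds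
  obtain ⟨t, ht, ht0⟩ := ((hcont.eventually (isOpen_interior.mem_nhds hc)).and
    self_mem_nhdsWithin).exists
  obtain ⟨N, hN⟩ := hu _ (hP.smul_mem_interior ht0 hc)
  refine ⟨N, fun n hn => ?_⟩
  have h := hP.add_mem_interior (hP.mul_mem s hs _ (interior_subset (hN n hn))) ht
  convert h using 1
  rw [mul_sub, mul_smul_comm]
  abel

/-- If `ρ(k) < 1`, then `1 - k` has a left inverse in the cone. -/
theorem IsCone.exists_mul_one_sub_eq_one [CompleteSpace A] (hP : IsCone P) {k : A} (hk : k ∈ P)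
    (h : specRad k < 1) : ∃ r ∈ P, r * (1 - k) = 1 := by
  obtain ⟨n, hn⟩ := exists_norm_pow_lt_one_of_specRad_lt_one h
  refine ⟨(∑' i : ℕ, (k ^ n) ^ i) * ∑ i ∈ Finset.range n, k ^ i, hP.mul_mem _
    (hP.tsum_mem (hP.pow_mem (hP.pow_mem hk n)) (summable_geometric_of_norm_lt_one hn)) _
    (hP.sum_mem (hP.pow_mem hk) _), ?_⟩
  rw [mul_assoc, geom_sum_mul_neg, geom_series_mul_neg _ hn]

end ConeLemmas

/-- If each `T n` has a fixed point `x n`, the family `(T n)` has property (H) with (H)-limit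
`T∞`, and `T∞` is a `k∞`-contraction with a unique fixed point `x∞`, then `(d (x n) x∞)` is a
c-sequence. -/
theorem fixedPoints_cSeq_of_hLimit {A : Type*} [NormedRing A] [NormedAlgebra ℝ A]
    [CompleteSpace A] {X : Type*} (P : Set A) (hP : IsCone P) (hsolid : (interior P).Nonempty)
    (d : X → X → A) (hd : IsConeMetric P d)
    (Xn : ℕ → Set X) (hXn : ∀ n, (Xn n).Nonempty) (Xinf : Set X) (hXinf : Xinf.Nonempty)
    (T : ℕ → X → X) (Tinf : X → X)
    (x : ℕ → X) (hx : ∀ n, x n ∈ Xn n) (hfix : ∀ n, T n (x n) = x n)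
    (hH : HLimit P d Xn Xinf T Tinf)
    (kinf : A) (hkinf : kinf ∈ P) (hρ : specRad kinf < 1)
    (hcontr : ∀ x ∈ Xinf, ∀ y ∈ Xinf, kinf * d x y - d (Tinf x) (Tinf y) ∈ P)
    (xinf : X) (hxinf : xinf ∈ Xinf) (hfixinf : Tinf xinf = xinf)
    (huniq : ∀ y ∈ Xinf, Tinf y = y → y = xinf) :
    CSeq P fun n => d (x n) xinf := by
  obtain ⟨v, hv, ha, hb⟩ := hH x hx
  simp only [hfix] at hb
  obtain ⟨r, hr, hr1⟩ := hP.exists_mul_one_sub_eq_one hkinf hρ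
  refine ((hb.add hP (ha.const_mul hP hkinf)).const_mul hP hr).mono hP fun n => ?_
  have h1 := hd.triangle (x n) (Tinf (v n)) xinf
  have h2 := hcontr (v n) (hv n) xinf hxinf
  have h3 := hP.mul_mem _ hkinf _ (hd.triangle (v n) (x n) xinf)
  rw [hfixinf] at h2
  rw [hd.symm (v n) (x n)] at h3
  have h4 := hP.mul_mem _ hr _ (hP.add_mem _ (hP.add_mem _ h1 _ h2) _ h3)
  convert h4 using 1
  calc r * (d (x n) (Tinf (v n)) + kinf * d (x n) (v n)) - d (x n) xinf
      = r * (d (x n) (Tinf (v n)) + kinf * d (x n) (v n)) - r * (1 - kinf) * d (x n) xinf := by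
        rw [hr1, one_mul]
    _ = _ := by noncomm_ring
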